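/- arXiv:1505.01632 — 3 statements merged into one kernel-verified Lean document; each statement's English description precedes it below -/
import Mathlib

section
/- For every f ∈ U, the Aubin–Nitsche duality estimate ‖ι(Sf − S_h f)‖_U ≤ κ ‖Sf − S_h f‖_a holds. -/
open scoped RealInnerProductSpace

/-- The energy norm `‖v‖_a = a(v,v)^{1/2}` associated with a bilinear form `a`. -/
noncomputable def energyNorm {H : Type*} [AddCommGroup H] [Module ℝ H]
    (a : H →ₗ[ℝ] H →ₗ[ℝ] ℝ) (v : H) : ℝ := Real.sqrt (a v v)

theorem energyNorm_nonneg {H : Type*} [AddCommGroup H] [Module ℝ H]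
    (a : H →ₗ[ℝ] H →ₗ[ℝ] ℝ) (v : H) : 0 ≤ energyNorm a v := Real.sqrt_nonneg _

/-- The **Cauchy–Schwarz inequality** in the energy norm. -/
theorem apply_le_energyNorm_mul_energyNorm {H : Type*} [AddCommGroup H] [Module ℝ H]
    {a : H →ₗ[ℝ] H →ₗ[ℝ] ℝ} (ha_symm : ∀ x y, a x y = a y x) (ha_nonneg : ∀ x, 0 ≤ a x x)
    (x y : H) : a x y ≤ energyNorm a x * energyNorm a y := by
  rw [energyNorm, energyNorm, ← Real.sqrt_mul (ha_nonneg x)]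
  exact Real.le_sqrt_of_sq_le
    (LinearMap.BilinForm.apply_sq_le_of_symm a ha_nonneg ⟨ha_symm⟩ x y)

/-- The a priori bound for the solution `u` of a coercive problem with right-hand side `⟪f, ι ·⟫`,
where `‖f‖ ≤ 1`. -/
theorem energyNorm_le_of_apply_self_eq_inner {U H : Type*}
    [NormedAddCommGroup U] [InnerProductSpace ℝ U] [NormedAddCommGroup H] [NormedSpace ℝ H]
    {ι : H →L[ℝ] U} {m : ℝ} (hm : 0 < m) {a : H →ₗ[ℝ] H →ₗ[ℝ] ℝ}
    (ha_coer : ∀ x, m * ‖x‖ ^ 2 ≤ a x x) {f : U} (hf : ‖f‖ ≤ 1) {u : H}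
    (hu : a u u = ⟪f, ι u⟫) : energyNorm a u ≤ Real.sqrt (‖ι‖ ^ 2 / m) := by
  refine Real.sqrt_le_sqrt ?_
  have hle : a u u ≤ ‖ι‖ * ‖u‖ := calc
    a u u ≤ ‖f‖ * ‖ι u‖ := hu.trans_le (real_inner_le_norm _ _)
    _ ≤ 1 * (‖ι‖ * ‖u‖) := by gcongr; exact ι.le_opNorm u
    _ = ‖ι‖ * ‖u‖ := one_mul _
  rw [le_div_iff₀ hm]
  nlinarith [ha_coer u, sq_nonneg (‖ι‖ - m * ‖u‖)]

/-- Aubin–Nitsche duality estimate: for every `f ∈ U`,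
`‖ι(Sf − S_h f)‖_U ≤ κ ‖Sf − S_h f‖_a`. -/
theorem aubin_nitsche_duality_estimate
    {U H : Type*}
    [NormedAddCommGroup U] [InnerProductSpace ℝ U] [CompleteSpace U]
    [NormedAddCommGroup H] [InnerProductSpace ℝ H] [CompleteSpace H]
    (ι : H →L[ℝ] U)
    (M m : ℝ) (hM : 0 < M) (hm : 0 < m)
    (a : H →ₗ[ℝ] H →ₗ[ℝ] ℝ)
    (ha_symm : ∀ x y, a x y = a y x)
    (ha_bdd : ∀ x y, |a x y| ≤ M * ‖x‖ * ‖y‖)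
    (ha_coer : ∀ x, m * ‖x‖ ^ 2 ≤ a x x)
    (S : U → H)
    (hS : ∀ f v, a (S f) v = ⟪f, ι v⟫)
    (Vh : Submodule ℝ H) (hVh : IsClosed (Vh : Set H))
    (Sh : U → H) (hShmem : ∀ f, Sh f ∈ Vh)
    (hSh : ∀ f, ∀ vh ∈ Vh, a (Sh f) vh = ⟪f, ι vh⟫)
    (κ : ℝ)
    (hκ : κ = ⨆ f : {f : U // ‖f‖ ≤ 1}, ⨅ vh : Vh, energyNorm a (S (f : U) - (vh : H))) :
    ∀ f : U, ‖ι (S f - Sh f)‖ ≤ κ * energyNorm a (S f - Sh f) := by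
  intro f
  have ha_nonneg (x : H) : 0 ≤ a x x := (by positivity : 0 ≤ m * ‖x‖ ^ 2).trans (ha_coer x)
  set e := S f - Sh f
  have galerkin_orthogonality : ∀ vh ∈ Vh, a vh e = 0 := fun vh hvh => by
    rw [ha_symm, map_sub a, LinearMap.sub_apply, hS, hSh f vh hvh, sub_self]
  have hbddBelow (g : U) : BddBelow (Set.range fun vh : Vh => energyNorm a (S g - (vh : H))) :=
    ⟨0, Set.forall_mem_range.2 fun _ => energyNorm_nonneg a _⟩
  have hbddAbove : BddAbove (Set.range fun g : {g : U // ‖g‖ ≤ 1} =>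
      ⨅ vh : Vh, energyNorm a (S (g : U) - (vh : H))) := by
    refine ⟨Real.sqrt (‖ι‖ ^ 2 / m), Set.forall_mem_range.2 fun g => ?_⟩
    refine (ciInf_le (hbddBelow g) 0).trans ?_
    rw [ZeroMemClass.coe_zero, sub_zero]
    exact energyNorm_le_of_apply_self_eq_inner hm ha_coer g.2 (hS g _)
  let g : U := ‖ι e‖⁻¹ • ι e
  have hg : ‖g‖ ≤ 1 := by
    rw [norm_smul, norm_inv, norm_norm]
    exact inv_mul_le_one
  have hge : ⟪g, ι e⟫ = ‖ι e‖ := by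
    rw [real_inner_smul_left, real_inner_self_eq_norm_mul_norm, ← mul_assoc]
    exact inv_mul_mul_self _
  calc ‖ι e‖ ≤ (⨅ vh : Vh, energyNorm a (S g - (vh : H))) * energyNorm a e := by
        rw [Real.iInf_mul_of_nonneg (energyNorm_nonneg a e)]
        refine le_ciInf fun vh => ?_
        calc ‖ι e‖ = a (S g - vh) e := by
              rw [map_sub a, LinearMap.sub_apply, galerkin_orthogonality vh vh.2, sub_zero, hS, hge]
          _ ≤ _ := apply_le_energyNorm_mul_energyNorm ha_symm ha_nonneg _ _
    _ ≤ κ * energyNorm a e := by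
        rw [hκ]
        exact mul_le_mul_of_nonneg_right (le_ciSup hbddAbove ⟨g, hg⟩) (energyNorm_nonneg a e)
end

section
/- The continuous and discrete optimal controls satisfy α ‖u − u_h‖_U² ≤ ⟨ι p_h − ι p, u − u_h⟩_U, where p = S(ι(Su) − y_d) and p_h = S_h(ι(S_h u_h) − y_d) are the continuous and discrete adjoint states. -/
open scoped RealInnerProductSpace

/-- A map `T` into a subspace `V` that represents `⟪f, ι ·⟫` on `V` through a symmetric form
gives a symmetric composite `ι ∘ T`. -/
lemma inner_comp_solution_comm {U H : Type*} [NormedAddCommGroup U] [InnerProductSpace ℝ U]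
    [AddCommGroup H] [Module ℝ H] {ι : H → U} {a : H →ₗ[ℝ] H →ₗ[ℝ] ℝ}
    (ha : ∀ x y, a x y = a y x) {V : Submodule ℝ H} {T : U → H} (hmem : ∀ f, T f ∈ V)
    (hT : ∀ f, ∀ v ∈ V, a (T f) v = ⟪f, ι v⟫) (f g : U) :
    ⟪ι (T f), g⟫ = ⟪f, ι (T g)⟫ := by
  rw [real_inner_comm, ← hT g _ (hmem f), ha, hT f _ (hmem g)]

/-- A symmetric map on an inner product space is affine along lines. -/
lemma map_add_smul_of_inner_comm {U : Type*} [NormedAddCommGroup U] [InnerProductSpace ℝ U]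
    {K : U → U} (hK : ∀ f g, ⟪K f, g⟫ = ⟪f, K g⟫) (f g : U) (t : ℝ) :
    K (f + t • g) = K f + t • K g := by
  refine ext_inner_right ℝ fun w => ?_
  simp only [inner_add_left, real_inner_smul_left, hK]

/-- If `A * t + B * t ^ 2` is nonnegative on `(0, 1]`, then `A` is nonnegative. -/
lemma nonneg_of_quadratic_nonneg {A B : ℝ}
    (h : ∀ t : ℝ, 0 < t → t ≤ 1 → 0 ≤ A * t + B * t ^ 2) : 0 ≤ A := by
  by_contra! hA
  have hd2 : 0 < |B| - 2 * A := by linarith [abs_nonneg B]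
  have ht : 0 < -A / (|B| - 2 * A) := div_pos (by linarith) hd2
  have ht1 : -A / (|B| - 2 * A) ≤ 1 := by
    rw [div_le_one hd2]
    linarith [abs_nonneg B]
  have key := h _ ht ht1
  set t := -A / (|B| - 2 * A)
  have hmul : t * (|B| - 2 * A) = -A := div_mul_cancel₀ _ hd2.ne'
  have hlin : 0 ≤ A + B * t := by
    refine nonneg_of_mul_nonneg_left (b := t) ?_ ht
    linarith [show (A + B * t) * t = A * t + B * t ^ 2 by ring]
  have hB : B * t ≤ |B| * t := mul_le_mul_of_nonneg_right (le_abs_self B) ht.le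
  nlinarith [mul_neg_of_pos_of_neg ht hA]

/-- First-order optimality condition for a Tikhonov-regularized least-squares functional with a
symmetric operator on a convex set. -/
lemma inner_gradient_nonneg_of_isMin {U : Type*} [NormedAddCommGroup U] [InnerProductSpace ℝ U]
    {K : U → U} (hK : ∀ f g, ⟪K f, g⟫ = ⟪f, K g⟫) {α : ℝ} {y : U} {C : Set U}
    (hC : Convex ℝ C) {u : U} (hu : u ∈ C)
    (hmin : ∀ v ∈ C, (1 / 2) * ‖K u - y‖ ^ 2 + (α / 2) * ‖u‖ ^ 2 ≤
      (1 / 2) * ‖K v - y‖ ^ 2 + (α / 2) * ‖v‖ ^ 2) {v : U} (hv : v ∈ C) :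
    0 ≤ α * ⟪u, v - u⟫ + ⟪K (K u - y), v - u⟫ := by
  rw [hK]
  refine nonneg_of_quadratic_nonneg
    (B := (1 / 2) * ‖K (v - u)‖ ^ 2 + (α / 2) * ‖v - u‖ ^ 2) fun t ht ht1 => ?_
  have h := hmin _ (hC.add_smul_sub_mem hu hv ⟨ht.le, ht1⟩)
  rw [map_add_smul_of_inner_comm hK, add_sub_right_comm, norm_add_sq_real (K u - y),
    norm_add_sq_real u, norm_smul, norm_smul, mul_pow, mul_pow, Real.norm_eq_abs, sq_abs,
    real_inner_smul_right, real_inner_smul_right] at h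
  linarith

/-- the continuous and discrete optimal controls satisfy
`α ‖u − u_h‖² ≤ ⟨ι p_h − ι p, u − u_h⟩`, where `p = S(ι(Su) − y_d)` and
`p_h = S_h(ι(S_h u_h) − y_d)`. -/
theorem control_error_sq_le_adjoint_difference
    {U H : Type*}
    [NormedAddCommGroup U] [InnerProductSpace ℝ U] [CompleteSpace U]
    [NormedAddCommGroup H] [InnerProductSpace ℝ H] [CompleteSpace H]
    (ι : H →L[ℝ] U)
    (M m : ℝ) (hM : 0 < M) (hm : 0 < m)
    (a : H →ₗ[ℝ] H →ₗ[ℝ] ℝ)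
    (ha_symm : ∀ x y, a x y = a y x)
    (ha_bdd : ∀ x y, |a x y| ≤ M * ‖x‖ * ‖y‖)
    (ha_coer : ∀ x, m * ‖x‖ ^ 2 ≤ a x x)
    (S : U → H)
    (hS : ∀ f v, a (S f) v = ⟪f, ι v⟫)
    (Vh : Submodule ℝ H) (hVh : IsClosed (Vh : Set H))
    (Sh : U → H) (hShmem : ∀ f, Sh f ∈ Vh)
    (hSh : ∀ f, ∀ vh ∈ Vh, a (Sh f) vh = ⟪f, ι vh⟫)
    (α : ℝ) (hα : 0 < α) (yd : U)
    (Uad : Set U) (hne : Uad.Nonempty) (hcl : IsClosed Uad) (hconv : Convex ℝ Uad)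
    (u : U) (hu : u ∈ Uad)
    (humin : ∀ v ∈ Uad,
      (1 / 2) * ‖ι (S u) - yd‖ ^ 2 + (α / 2) * ‖u‖ ^ 2 ≤
        (1 / 2) * ‖ι (S v) - yd‖ ^ 2 + (α / 2) * ‖v‖ ^ 2)
    (uh : U) (huh : uh ∈ Uad)
    (huhmin : ∀ v ∈ Uad,
      (1 / 2) * ‖ι (Sh uh) - yd‖ ^ 2 + (α / 2) * ‖uh‖ ^ 2 ≤
        (1 / 2) * ‖ι (Sh v) - yd‖ ^ 2 + (α / 2) * ‖v‖ ^ 2) :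
    α * ‖u - uh‖ ^ 2 ≤ ⟪ι (Sh (ι (Sh uh) - yd)) - ι (S (ι (S u) - yd)), u - uh⟫ := by
  have hK := inner_comp_solution_comm (ι := ι) ha_symm (V := ⊤) (T := S)
    (fun _ => Submodule.mem_top) (fun f v _ => hS f v)
  have hKh := inner_comp_solution_comm (ι := ι) ha_symm hShmem hSh
  have h := inner_gradient_nonneg_of_isMin (K := fun f => ι (S f)) hK hconv hu humin huh
  have hh := inner_gradient_nonneg_of_isMin (K := fun f => ι (Sh f)) hKh hconv huh huhmin hu
  rw [← neg_sub u uh, inner_neg_right, inner_neg_right] at h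
  have hsq : ‖u - uh‖ ^ 2 = ⟪u, u - uh⟫ - ⟪uh, u - uh⟫ := by
    rw [← inner_sub_left, real_inner_self_eq_norm_sq]
  rw [inner_sub_left, hsq]
  linarith
end

section
/- The continuous and discrete optimal controls satisfy ‖u − u_h‖_U ≤ α^{−1} ‖ι( S_h(ι(S_h u) − y_d) − S(ι(S u) − y_d) )‖_U; that is, the control error is bounded by α^{−1} times the U-norm of the adjoint consistency error evaluated at the continuous optimal control u. -/
open scoped RealInnerProductSpace

section Galerkin

variable {U H : Type*} [NormedAddCommGroup U] [InnerProductSpace ℝ U]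
  [NormedAddCommGroup H] [InnerProductSpace ℝ H]

/-- Vectors of a subspace are determined by testing a coercive form against that subspace. -/
theorem eq_of_forall_coercive_form_eq {m : ℝ} (hm : 0 < m) {a : H →ₗ[ℝ] H →ₗ[ℝ] ℝ}
    (ha : ∀ x, m * ‖x‖ ^ 2 ≤ a x x) {V : Submodule ℝ H} {x y : H} (hx : x ∈ V) (hy : y ∈ V)
    (h : ∀ v ∈ V, a x v = a y v) : x = y := by
  have h0 : a (x - y) (x - y) = 0 := by
    rw [map_sub a, LinearMap.sub_apply, h _ (V.sub_mem hx hy), sub_self]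
  have h1 : ‖x - y‖ ^ 2 ≤ 0 := by
    have := ha (x - y)
    rw [h0] at this
    exact nonpos_of_mul_nonpos_right this hm
  exact sub_eq_zero.mp (norm_eq_zero.mp (by nlinarith [norm_nonneg (x - y)]))

/-- A Galerkin solution operator of a coercive form is linear. -/
theorem isLinearMap_of_galerkin {ι : H →L[ℝ] U} {m : ℝ} (hm : 0 < m)
    {a : H →ₗ[ℝ] H →ₗ[ℝ] ℝ} (ha : ∀ x, m * ‖x‖ ^ 2 ≤ a x x) {V : Submodule ℝ H} {S : U → H}
    (hmem : ∀ f, S f ∈ V) (hS : ∀ f, ∀ v ∈ V, a (S f) v = ⟪f, ι v⟫) : IsLinearMap ℝ S where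
  map_add f g := by
    refine eq_of_forall_coercive_form_eq hm ha (hmem _) (V.add_mem (hmem f) (hmem g)) ?_
    intro v hv
    simp [hS _ v hv, inner_add_left]
  map_smul c f := by
    refine eq_of_forall_coercive_form_eq hm ha (hmem _) (V.smul_mem c (hmem f)) ?_
    intro v hv
    simp [hS _ v hv, real_inner_smul_left]

/-- The control-to-observation operator of a symmetric coercive form is a symmetric linear map. -/
theorem exists_isSymmetric_of_galerkin {ι : H →L[ℝ] U} {m : ℝ} (hm : 0 < m)
    {a : H →ₗ[ℝ] H →ₗ[ℝ] ℝ} (hsymm : ∀ x y, a x y = a y x) (ha : ∀ x, m * ‖x‖ ^ 2 ≤ a x x)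
    {V : Submodule ℝ H} {S : U → H} (hmem : ∀ f, S f ∈ V)
    (hS : ∀ f, ∀ v ∈ V, a (S f) v = ⟪f, ι v⟫) :
    ∃ T : U →ₗ[ℝ] U, T.IsSymmetric ∧ ∀ f, ι (S f) = T f := by
  refine ⟨ι.toLinearMap ∘ₗ (isLinearMap_of_galerkin hm ha hmem hS).mk' S, ?_, fun f => rfl⟩
  intro f g
  change ⟪ι (S f), g⟫ = ⟪f, ι (S g)⟫
  rw [real_inner_comm, ← hS g _ (hmem f), ← hS f _ (hmem g), hsymm]

/-- First-order optimality condition for a regularized least-squares functional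
with symmetric control-to-observation map. -/
theorem inner_nonneg_of_isMinOn_regularized {T : U →ₗ[ℝ] U} (hT : T.IsSymmetric) {α : ℝ} {y : U}
    {K : Set U} (hK : Convex ℝ K) {u : U} (hu : u ∈ K)
    (hmin : ∀ v ∈ K, (1 / 2) * ‖T u - y‖ ^ 2 + (α / 2) * ‖u‖ ^ 2 ≤
      (1 / 2) * ‖T v - y‖ ^ 2 + (α / 2) * ‖v‖ ^ 2) {v : U} (hv : v ∈ K) :
    0 ≤ ⟪T (T u - y) + α • u, v - u⟫ := by
  set d := v - u with hd
  set g := ⟪T (T u - y) + α • u, d⟫ with hg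
  set Q := (1 / 2) * ‖T d‖ ^ 2 + (α / 2) * ‖d‖ ^ 2 with hQ
  have key : ∀ t : ℝ, 0 < t → t ≤ 1 → 0 ≤ g + t * Q := by
    intro t ht ht1
    have h := hmin _ (hK.add_smul_sub_mem hu hv ⟨ht.le, ht1⟩)
    have e1 : T (u + t • d) - y = (T u - y) + t • T d := by
      rw [map_add, map_smul]
      abel
    have e2 : g = ⟪T u - y, T d⟫ + α * ⟪u, d⟫ := by
      rw [hg, inner_add_left, hT, real_inner_smul_left]
    rw [← hd, e1, norm_add_sq_real, norm_add_sq_real, real_inner_smul_right,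
      real_inner_smul_right, norm_smul, norm_smul, mul_pow, mul_pow, Real.norm_eq_abs,
      sq_abs] at h
    have h' : 0 ≤ t * (g + t * Q) := by
      rw [e2, hQ]
      linarith
    exact nonneg_of_mul_nonneg_right h' ht
  by_contra! hneg
  have hQpos : 0 < Q := by linarith [key 1 one_pos le_rfl]
  have ht : 0 < -g / (2 * Q) := by
    apply div_pos <;> linarith
  have hle : -g / (2 * Q) ≤ 1 := by
    rw [div_le_one (by linarith)]
    linarith [key 1 one_pos le_rfl]
  have h := key _ ht hle
  have e : -g / (2 * Q) * Q = -g / 2 := by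
    field_simp
  rw [e] at h
  linarith

end Galerkin

/-- the control error is bounded by `α⁻¹` times the `U`-norm of the
adjoint consistency error evaluated at the continuous optimal control `u`:
`‖u − u_h‖ ≤ α⁻¹ ‖ι(S_h(ι(S_h u) − y_d) − S(ι(Su) − y_d))‖`. -/
theorem control_error_le_adjoint_consistency
    {U H : Type*}
    [NormedAddCommGroup U] [InnerProductSpace ℝ U] [CompleteSpace U]
    [NormedAddCommGroup H] [InnerProductSpace ℝ H] [CompleteSpace H]
    (ι : H →L[ℝ] U)
    (M m : ℝ) (hM : 0 < M) (hm : 0 < m)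
    (a : H →ₗ[ℝ] H →ₗ[ℝ] ℝ)
    (ha_symm : ∀ x y, a x y = a y x)
    (ha_bdd : ∀ x y, |a x y| ≤ M * ‖x‖ * ‖y‖)
    (ha_coer : ∀ x, m * ‖x‖ ^ 2 ≤ a x x)
    (S : U → H)
    (hS : ∀ f v, a (S f) v = ⟪f, ι v⟫)
    (Vh : Submodule ℝ H) (hVh : IsClosed (Vh : Set H))
    (Sh : U → H) (hShmem : ∀ f, Sh f ∈ Vh)
    (hSh : ∀ f, ∀ vh ∈ Vh, a (Sh f) vh = ⟪f, ι vh⟫)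
    (α : ℝ) (hα : 0 < α) (yd : U)
    (Uad : Set U) (hne : Uad.Nonempty) (hcl : IsClosed Uad) (hconv : Convex ℝ Uad)
    (u : U) (hu : u ∈ Uad)
    (humin : ∀ v ∈ Uad,
      (1 / 2) * ‖ι (S u) - yd‖ ^ 2 + (α / 2) * ‖u‖ ^ 2 ≤
        (1 / 2) * ‖ι (S v) - yd‖ ^ 2 + (α / 2) * ‖v‖ ^ 2)
    (uh : U) (huh : uh ∈ Uad)
    (huhmin : ∀ v ∈ Uad,
      (1 / 2) * ‖ι (Sh uh) - yd‖ ^ 2 + (α / 2) * ‖uh‖ ^ 2 ≤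
        (1 / 2) * ‖ι (Sh v) - yd‖ ^ 2 + (α / 2) * ‖v‖ ^ 2) :
    ‖u - uh‖ ≤ α⁻¹ * ‖ι (Sh (ι (Sh u) - yd) - S (ι (S u) - yd))‖ := by
  obtain ⟨T, hT, hST⟩ := exists_isSymmetric_of_galerkin (V := ⊤) hm ha_symm ha_coer
    (fun f => Submodule.mem_top) (fun f v _ => hS f v)
  obtain ⟨Th, hTh, hSTh⟩ := exists_isSymmetric_of_galerkin hm ha_symm ha_coer hShmem hSh
  simp only [map_sub ι, hST, hSTh] at humin huhmin ⊢
  have h1 := inner_nonneg_of_isMinOn_regularized hT hconv hu humin huh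
  have h2 := inner_nonneg_of_isMinOn_regularized hTh hconv huh huhmin hu
  set r := Th (Th u - yd) - T (T u - yd) with hr
  have hpos : 0 ≤ ⟪Th (Th (u - uh)), u - uh⟫ := by
    rw [hTh]
    exact real_inner_self_nonneg
  have hsum : α * ‖u - uh‖ ^ 2 + ⟪Th (Th (u - uh)), u - uh⟫ ≤ ⟪r, u - uh⟫ := by
    rw [← neg_sub u uh, inner_neg_right] at h1
    rw [← real_inner_self_eq_norm_sq, ← real_inner_smul_left, ← inner_add_left, ← sub_nonneg,
      ← inner_sub_left]
    have e : r - (α • (u - uh) + Th (Th (u - uh))) =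
        (Th (Th uh - yd) + α • uh) - (T (T u - yd) + α • u) := by
      simp only [hr, map_sub, smul_sub]
      abel
    rw [e, inner_sub_left]
    linarith
  have hcs := real_inner_le_norm r (u - uh)
  rw [← div_eq_inv_mul, le_div_iff₀ hα]
  rcases (norm_nonneg (u - uh)).eq_or_lt with h0 | h0
  · rw [← h0, zero_mul]
    exact norm_nonneg r
  · refine le_of_mul_le_mul_right ?_ h0
    linarith
end
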